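/- Let ω > 0, p a positive integer, and (X₀,Y₀) ∈ ℝ² with (X₀,Y₀) ≠ (0,0). Then ∫₀^{2pπ/ω} cos(ωτ)·sgn(Y₀ cos(ωτ) + X₀ sin(ωτ)) dτ = 4pY₀/(ω√(X₀² + Y₀²)). -/

import Mathlib

open MeasureTheory intervalIntegral in
/-- Over one period centred at the phase `φ`, `cos u * sign (cos (u - φ))` is interval integrable,
with integral `4 * cos φ`. -/
theorem intervalIntegrable_and_integral_cos_mul_sign_cos_sub (φ : ℝ) :
    IntervalIntegrable (fun u => Real.cos u * Real.sign (Real.cos (u - φ))) volume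
        (φ - Real.pi / 2) (φ - Real.pi / 2 + 2 * Real.pi) ∧
      ∫ u in (φ - Real.pi / 2)..(φ - Real.pi / 2 + 2 * Real.pi),
        Real.cos u * Real.sign (Real.cos (u - φ)) = 4 * Real.cos φ := by
  have hπ := Real.pi_pos
  have h₁ : Set.EqOn Real.cos (fun u => Real.cos u * Real.sign (Real.cos (u - φ)))
      (Set.uIoo (φ - Real.pi / 2) (φ + Real.pi / 2)) := by
    rw [Set.uIoo_of_le (by linarith)]
    rintro u ⟨hu₁, hu₂⟩
    have hpos : 0 < Real.cos (u - φ) :=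
      Real.cos_pos_of_mem_Ioo ⟨by linarith, by linarith⟩
    simp [Real.sign_of_pos hpos]
  have h₂ : Set.EqOn (fun u => -Real.cos u)
      (fun u => Real.cos u * Real.sign (Real.cos (u - φ)))
      (Set.uIoo (φ + Real.pi / 2) (φ - Real.pi / 2 + 2 * Real.pi)) := by
    rw [Set.uIoo_of_le (by linarith)]
    rintro u ⟨hu₁, hu₂⟩
    have hneg : Real.cos (u - φ) < 0 :=
      Real.cos_neg_of_pi_div_two_lt_of_lt (by linarith) (by linarith)
    simp [Real.sign_of_neg hneg]
  have i₁ := (Real.continuous_cos.intervalIntegrable (μ := volume) _ _).congr_uIoo h₁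
  have i₂ := (Real.continuous_cos.neg.intervalIntegrable (μ := volume) _ _).congr_uIoo h₂
  refine ⟨i₁.trans i₂, ?_⟩
  rw [← integral_add_adjacent_intervals i₁ i₂, ← integral_congr_uIoo h₁,
    ← integral_congr_uIoo h₂, intervalIntegral.integral_neg, integral_cos, integral_cos,
    Real.sin_add_two_pi, Real.sin_add_pi_div_two, Real.sin_sub_pi_div_two]
  ring

open MeasureTheory in
/-- The integral of `cos u * sign (cos (u - φ))` over `n` full periods is `4 * n * cos φ`. -/
theorem integral_cos_mul_sign_cos_sub (φ : ℝ) (n : ℕ) :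
    ∫ u in (0 : ℝ)..(2 * (n : ℝ) * Real.pi), Real.cos u * Real.sign (Real.cos (u - φ))
      = 4 * n * Real.cos φ := by
  have hper : Function.Periodic (fun u => Real.cos u * Real.sign (Real.cos (u - φ)))
      (2 * Real.pi) := by
    intro u
    simp only [Real.cos_add_two_pi, add_sub_right_comm]
  obtain ⟨hint, hval⟩ := intervalIntegrable_and_integral_cos_mul_sign_cos_sub φ
  have hsum := hper.intervalIntegral_add_zsmul_eq n 0
    (hper.intervalIntegrable Real.two_pi_pos.ne' hint)
  rw [hper.intervalIntegral_add_eq 0 (φ - Real.pi / 2), hval] at hsum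
  simp only [zero_add, natCast_zsmul, nsmul_eq_mul] at hsum
  rw [show 2 * (n : ℝ) * Real.pi = n * (2 * Real.pi) by ring, hsum]
  ring

/-- Multiplying by a positive real does not change the sign. -/
theorem Real.sign_mul_of_pos_left {r : ℝ} (hr : 0 < r) (x : ℝ) :
    Real.sign (r * x) = Real.sign x := by
  rcases lt_trichotomy x 0 with hx | rfl | hx
  · rw [Real.sign_of_neg hx, Real.sign_of_neg (mul_neg_of_pos_of_neg hr hx)]
  · rw [mul_zero]
  · rw [Real.sign_of_pos hx, Real.sign_of_pos (mul_pos hr hx)]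

/-- Polar coordinates for a nonzero vector of the plane. -/
theorem exists_polar_of_ne_zero (x y : ℝ) (h : (y, x) ≠ (0, 0)) :
    0 < Real.sqrt (y ^ 2 + x ^ 2) ∧ ∃ φ : ℝ,
      x = Real.sqrt (y ^ 2 + x ^ 2) * Real.cos φ ∧
      y = Real.sqrt (y ^ 2 + x ^ 2) * Real.sin φ := by
  have hnorm : ‖(⟨x, y⟩ : ℂ)‖ = Real.sqrt (y ^ 2 + x ^ 2) := by
    rw [Complex.norm_eq_sqrt_sq_add_sq, add_comm]
  rw [← hnorm]
  refine ⟨norm_pos_iff.mpr fun h₀ => h ?_, Complex.arg ⟨x, y⟩,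
    (Complex.norm_mul_cos_arg ⟨x, y⟩).symm, (Complex.norm_mul_sin_arg ⟨x, y⟩).symm⟩
  simpa [Complex.ext_iff, and_comm] using h₀


/-- For `ω > 0`, `p` a positive integer and `(X₀,Y₀) ≠ (0,0)`,
`∫₀^{2pπ/ω} cos(ωτ)·sgn(Y₀cos(ωτ) + X₀sin(ωτ)) dτ = 4pY₀/(ω√(X₀²+Y₀²))`,
where `sgn u = 1` for `u > 0`, `−1` for `u < 0` and `0` at `0`.  This integral arises in the
averaged function `ℱ₂` of the non-smooth perturbed double pendulum. -/
theorem stmt15 (ω : ℝ) (hω : 0 < ω) (p : ℕ) (hp : 0 < p)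
    (X₀ Y₀ : ℝ) (h : (X₀, Y₀) ≠ (0, 0)) :
    ∫ τ in (0 : ℝ)..(2 * (p : ℝ) * Real.pi / ω),
        Real.cos (ω * τ) * Real.sign (Y₀ * Real.cos (ω * τ) + X₀ * Real.sin (ω * τ))
      = 4 * (p : ℝ) * Y₀ / (ω * Real.sqrt (X₀ ^ 2 + Y₀ ^ 2)) := by
  obtain ⟨hr, φ, hY, hX⟩ := exists_polar_of_ne_zero Y₀ X₀ h
  set r := Real.sqrt (X₀ ^ 2 + Y₀ ^ 2)
  have hsign (u : ℝ) : Real.sign (Y₀ * Real.cos u + X₀ * Real.sin u)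
      = Real.sign (Real.cos (u - φ)) := by
    rw [← Real.sign_mul_of_pos_left hr (Real.cos (u - φ)), Real.cos_sub]
    congr 1
    linear_combination Real.cos u * hY + Real.sin u * hX
  simp only [hsign]
  rw [intervalIntegral.integral_comp_mul_left
      (fun u => Real.cos u * Real.sign (Real.cos (u - φ))) hω.ne',
    mul_zero, mul_div_cancel₀ _ hω.ne', integral_cos_mul_sign_cos_sub, smul_eq_mul,
    eq_div_iff (mul_pos hω hr).ne', inv_mul_eq_div, div_mul_eq_mul_div,
    div_eq_iff hω.ne']
  linear_combination -4 * (p : ℝ) * ω * hY
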